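/- arXiv:2402.05038 — 2 statements merged into one kernel-verified Lean document; each statement's English description precedes it below -/
import Mathlib

section
/- Let $(V,E)$ be a rooted directed tree with root $\mathrm{o}$, $\mu$ a weight, $1<p<\infty$, and suppose the backward shift $B$ is bounded on $X=\ell^p(V,\mu)$. If there is an increasing sequence $(n_k)$ of positive integers such that $\sum_{u\in\mathrm{Chi}^{n_k}(\mathrm{o})}|\mu_u|^{-p^*}\to+\infty$, then there exists $f\in\ell^p(V,\mu)$ and a subsequence $(n_{k_j})$ such that $B^{n_{k_j}}f\to e_{\mathrm{o}}$ in norm; in particular $B$ has an orbit with $e_{\mathrm{o}}$ as a limit point. -/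
open scoped ENNReal NNReal

/-- A directed tree: a countable connected directed graph without circuits in
which every vertex has at most one parent. -/
structure DirTree {V : Type*} (E : V → V → Prop) : Prop where
  ne : ∀ u v : V, E u v → u ≠ v
  connected : ∀ u v : V, u ≠ v → ∃ n : ℕ, ∃ w : Fin (n + 2) → V,
    w 0 = u ∧ w (Fin.last (n + 1)) = v ∧
    ∀ i : Fin (n + 1), E (w i.castSucc) (w i.succ) ∨ E (w i.succ) (w i.castSucc)
  noCircuit : ∀ n : ℕ, ∀ w : Fin (n + 2) → V, Function.Injective w →
    ¬ ∀ i : Fin (n + 2), E (w i) (w (i + 1))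
  uniqueParent : ∀ v u₁ u₂ : V, E u₁ v → E u₂ v → u₁ = u₂

/-- The backward shift associated with an edge relation:
`(Bf)(v) = ∑_{u ∈ Chi(v)} f(u)`. -/
noncomputable def Bop {V 𝕜 : Type*} [RCLike 𝕜] (E : V → V → Prop) (f : V → 𝕜) : V → 𝕜 :=
  fun v => ∑' u : {u // E v u}, f u

/-- The weighted `ℓ^p`-"norm" `(∑_v |f(v) μ(v)|^p)^{1/p}`, valued in `ℝ≥0∞`. -/
noncomputable def pnorm {V 𝕜 : Type*} [RCLike 𝕜] (μ : V → 𝕜) (p : ℝ) (f : V → 𝕜) : ℝ≥0∞ :=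
  (∑' v, (‖f v * μ v‖₊ : ℝ≥0∞) ^ p) ^ (1 / p)


/-- `chiIter E n v` is `Chi^n(v)`, the set of `n`-th generation descendants of `v`. -/
def chiIter {V : Type*} (E : V → V → Prop) : ℕ → V → Set V
  | 0, v => {v}
  | n + 1, v => {u | ∃ w, E v w ∧ u ∈ chiIter E n w}


open Filter

namespace Stmt13Aux

variable {V 𝕜 : Type*} [RCLike 𝕜] {E : V → V → Prop}

/-- The `p`-th power of the weighted norm. -/
noncomputable def NN (μ : V → 𝕜) (p : ℝ) (f : V → 𝕜) : ℝ≥0∞ :=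
  ∑' v, (‖f v * μ v‖₊ : ℝ≥0∞) ^ p

theorem mem_chiIter_succ (n : ℕ) : ∀ v u : V,
    u ∈ chiIter E (n + 1) v ↔ ∃ w ∈ chiIter E n v, E w u := by
  induction n with
  | zero =>
    intro v u
    simp [chiIter]
  | succ n ih =>
    intro v u
    constructor
    · rintro ⟨w, hw, hu⟩
      obtain ⟨x, hx, hxu⟩ := (ih w u).1 hu
      exact ⟨x, ⟨w, hw, hx⟩, hxu⟩
    · rintro ⟨x, ⟨w, hw, hx⟩, hxu⟩
      exact ⟨w, hw, (ih w u).2 ⟨x, hx, hxu⟩⟩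

theorem level_unique (hT : DirTree E) (o : V) (ho : ∀ u, ¬ E u o) (m : ℕ) :
    ∀ (m' : ℕ) (w : V), w ∈ chiIter E m o → w ∈ chiIter E m' o → m = m' := by
  induction m with
  | zero =>
    intro m' w h h'
    cases m' with
    | zero => rfl
    | succ k =>
      obtain ⟨x, -, hx⟩ := (mem_chiIter_succ k o w).1 h'
      have : w = o := h
      subst this
      exact (ho _ hx).elim
  | succ m ih =>
    intro m' w h h'
    obtain ⟨x, hxm, hx⟩ := (mem_chiIter_succ m o w).1 h
    cases m' with
    | zero =>
      have : w = o := h'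
      subst this
      exact (ho _ hx).elim
    | succ k =>
      obtain ⟨y, hym, hy⟩ := (mem_chiIter_succ k o w).1 h'
      have := hT.uniqueParent _ _ _ hx hy
      subst this
      rw [ih k x hxm hym]

theorem exists_lev (hT : DirTree E) (o : V) (ho : ∀ u, ¬ E u o)
    (hreach : ∀ w : V, ∃ m : ℕ, w ∈ chiIter E m o) :
    ∃ lev : V → ℕ, (∀ v m, v ∈ chiIter E m o ↔ lev v = m) ∧
      (∀ u v, E u v → lev v = lev u + 1) ∧ (∀ v, lev v = 0 ↔ v = o) ∧
      (∀ v m, lev v = m + 1 → ∃ u, E u v) := by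
  choose lev hlev using hreach
  have key : ∀ v m, v ∈ chiIter E m o ↔ lev v = m := fun v m =>
    ⟨fun h => level_unique hT o ho _ _ v (hlev v) h, fun h => h ▸ hlev v⟩
  refine ⟨lev, key, ?_, ?_, ?_⟩
  · intro u v h
    exact (key _ _).1 ((mem_chiIter_succ _ _ _).2 ⟨u, hlev u, h⟩)
  · intro v
    rw [← key]
    rfl
  · intro v m h
    obtain ⟨x, -, hx⟩ := (mem_chiIter_succ _ _ _).1 ((key _ _).2 h)
    exact ⟨x, hx⟩

theorem iter_congr (lev : V → ℕ) (hlev : ∀ u v, E u v → lev v = lev u + 1) (m : ℕ) :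
    ∀ (f g : V → 𝕜) (l : ℕ), (∀ v, lev v = l + m → f v = g v) →
      ∀ w, lev w = l → (Bop E)^[m] f w = (Bop E)^[m] g w := by
  induction m with
  | zero => intro f g l h w hw; exact h w (by simpa using hw)
  | succ m ih =>
    intro f g l h w hw
    rw [Function.iterate_succ_apply, Function.iterate_succ_apply]
    refine ih _ _ l ?_ w hw
    intro v hv
    unfold Bop
    refine tsum_congr ?_
    rintro ⟨u, hu⟩
    exact h u (by have := hlev _ _ hu; omega)

theorem iter_zero (m : ℕ) : (Bop E)^[m] (fun _ => (0 : 𝕜)) = fun _ => 0 := by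
  induction m with
  | zero => rfl
  | succ m ih =>
    rw [Function.iterate_succ_apply']
    rw [ih]
    funext v
    simp [Bop]

open Classical in
theorem iter_root (hT : DirTree E) (o : V) (lev : V → ℕ)
    (hlev : ∀ u v, E u v → lev v = lev u + 1) (h0 : ∀ v, lev v = 0 ↔ v = o)
    (hpar : ∀ v m, lev v = m + 1 → ∃ u, E u v) (m : ℕ) :
    ∀ (F : Finset V) (g : V → 𝕜), (∀ u ∈ F, lev u = m) → (∀ u, u ∉ F → g u = 0) →
      (Bop E)^[m] g o = ∑ u ∈ F, g u := by
  induction m with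
  | zero =>
    intro F g hF hg
    simp only [Function.iterate_zero, id]
    symm
    apply Finset.sum_eq_single o
    · intro b hb hbo
      exact (hbo ((h0 b).1 (hF b hb))).elim
    · exact hg o
  | succ m ih =>
    intro F g hF hg
    rw [Function.iterate_succ_apply]
    have hex : ∀ u, ∃ x, u ∈ F → E x u := by
      intro u
      by_cases hu : u ∈ F
      · obtain ⟨x, hx⟩ := hpar u m (hF u hu)
        exact ⟨x, fun _ => hx⟩
      · exact ⟨o, fun h => (hu h).elim⟩
    choose par hpar' using hex
    have hBv : ∀ v, Bop E g v = ∑ u ∈ F with par u = v, g u := by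
      intro v
      have e1 : Bop E g v = ∑' u, Set.indicator {u | E v u} g u := by
        unfold Bop
        exact tsum_subtype {u | E v u} g
      rw [e1, tsum_eq_sum (s := F)]
      · rw [Finset.sum_filter]
        refine Finset.sum_congr rfl ?_
        intro u hu
        by_cases h : par u = v
        · have : E v u := h ▸ hpar' u hu
          simp [h, this]
        · have : ¬ E v u := fun h' => h (hT.uniqueParent _ _ _ (hpar' u hu) h')
          simp [h, this]
      · intro u hu
        simp [Set.indicator, hg u hu]
    rw [ih (F.image par) (Bop E g)]
    · simp_rw [hBv]
      exact Finset.sum_fiberwise_of_maps_to (fun u hu => Finset.mem_image_of_mem _ hu) g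
    · intro v hv
      obtain ⟨u, hu, rfl⟩ := Finset.mem_image.1 hv
      have := hlev _ _ (hpar' u hu)
      have := hF u hu
      omega
    · intro v hv
      rw [hBv]
      apply Finset.sum_eq_zero
      intro u hu
      rw [Finset.mem_filter] at hu
      exact (hv (hu.2 ▸ Finset.mem_image_of_mem _ hu.1)).elim

theorem NN_iter (μ : V → 𝕜) (p : ℝ) (K : ℝ≥0∞)
    (hK : ∀ f : V → 𝕜, NN μ p (Bop E f) ≤ K * NN μ p f) (m : ℕ) (f : V → 𝕜) :
    NN μ p ((Bop E)^[m] f) ≤ K ^ m * NN μ p f := by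
  induction m with
  | zero => simp
  | succ m ih =>
    rw [Function.iterate_succ_apply']
    calc _ ≤ K * NN μ p ((Bop E)^[m] f) := hK _
      _ ≤ K * (K ^ m * NN μ p f) := by gcongr
      _ = _ := by ring

theorem exists_g (μ : V → 𝕜) (hμ : ∀ w, μ w ≠ 0) (p : ℝ) (hp : 1 < p) (A : Set V)
    (ε : ℝ≥0∞)
    (h : (ε⁻¹) ^ (1 / (p - 1)) < ∑' u : A, (‖μ u.1‖₊ : ℝ≥0∞) ^ (-(p / (p - 1)))) :
    ∃ (F : Finset V) (g : V → 𝕜), (∀ u ∈ F, u ∈ A) ∧ (∀ u, u ∉ F → g u = 0) ∧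
      ∑ u ∈ F, g u = 1 ∧ NN μ p g ≤ ε := by
  classical
  rw [ENNReal.tsum_eq_iSup_sum, lt_iSup_iff] at h
  obtain ⟨F0, hF0⟩ := h
  set q := p / (p - 1) with hq
  have hp1 : 0 < p - 1 := by linarith
  have hμ0 : ∀ u, 0 < ‖μ u‖₊ := fun u => by simpa [pos_iff_ne_zero] using hμ u
  set F : Finset V := F0.map (Function.Embedding.subtype _) with hF
  set S : ℝ≥0 := ∑ u ∈ F, ‖μ u‖₊ ^ (-q) with hS
  have hSeq : ∑ u ∈ F0, (‖μ u.1‖₊ : ℝ≥0∞) ^ (-q) = (S : ℝ≥0∞) := by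
    rw [hS, hF, Finset.sum_map]
    push_cast
    refine Finset.sum_congr rfl fun u _ => ?_
    rw [← ENNReal.coe_rpow_of_ne_zero (hμ0 _).ne']
    rfl
  rw [hSeq] at hF0
  have hSpos : 0 < S := by
    have : (0 : ℝ≥0∞) < S := lt_of_le_of_lt (zero_le) hF0
    exact_mod_cast this
  refine ⟨F, fun u => if u ∈ F then (((‖μ u‖₊ ^ (-q) / S : ℝ≥0) : ℝ) : 𝕜) else 0, ?_, ?_, ?_, ?_⟩
  · intro u hu
    rw [hF, Finset.mem_map] at hu
    obtain ⟨x, -, rfl⟩ := hu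
    exact x.2
  · intro u hu
    simp [hu]
  · rw [Finset.sum_congr rfl (fun u hu => if_pos hu)]
    have : ∑ u ∈ F, (‖μ u‖₊ ^ (-q) / S) = 1 := by
      rw [← Finset.sum_div, ← hS, div_self hSpos.ne']
    exact_mod_cast congrArg (fun x : ℝ≥0 => ((x : ℝ) : 𝕜)) this
  · have e1 : NN μ p (fun u => if u ∈ F then (((‖μ u‖₊ ^ (-q) / S : ℝ≥0) : ℝ) : 𝕜) else 0)
        = ((∑ u ∈ F, (‖μ u‖₊ ^ (-q) / S * ‖μ u‖₊) ^ p : ℝ≥0) : ℝ≥0∞) := by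
      unfold NN
      rw [tsum_eq_sum (s := F)]
      · rw [ENNReal.ofNNReal_finsetSum]
        refine Finset.sum_congr rfl fun u hu => ?_
        beta_reduce
        rw [if_pos hu, ENNReal.coe_rpow_of_nonneg _ (by linarith)]
        congr 2
        rw [nnnorm_mul]
        congr 1
        ext
        rw [coe_nnnorm, RCLike.norm_ofReal]
        exact abs_of_nonneg (NNReal.coe_nonneg _)
      · intro u hu
        beta_reduce
        rw [if_neg hu]
        have : 0 < p := by linarith
        simp [this]
    have e2 : ∑ u ∈ F, (‖μ u‖₊ ^ (-q) / S * ‖μ u‖₊) ^ p = (S ^ (p - 1))⁻¹ := by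
      have : ∀ u ∈ F, (‖μ u‖₊ ^ (-q) / S * ‖μ u‖₊) ^ p = ‖μ u‖₊ ^ (-q) * S ^ (-p) := by
        intro u _
        have h1 : ‖μ u‖₊ ^ (-q) / S * ‖μ u‖₊ = ‖μ u‖₊ ^ (-q + 1) * S⁻¹ := by
          rw [NNReal.rpow_add (hμ0 u).ne', NNReal.rpow_one]
          ring
        rw [h1, NNReal.mul_rpow, ← NNReal.rpow_mul, NNReal.inv_rpow, NNReal.rpow_neg S]
        have h2 : (-q + 1) * p = -q := by
          rw [hq]
          field_simp
          ring
        rw [h2]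
      rw [Finset.sum_congr rfl this, ← Finset.sum_mul, ← hS, ← NNReal.rpow_neg]
      nth_rewrite 1 [← NNReal.rpow_one S]
      rw [← NNReal.rpow_add hSpos.ne']
      congr 1
      ring
    rw [e1, e2, ENNReal.coe_inv (NNReal.rpow_pos hSpos).ne',
      ENNReal.coe_rpow_of_nonneg _ hp1.le]
    rw [ENNReal.inv_le_iff_inv_le]
    have := ENNReal.rpow_le_rpow hF0.le hp1.le
    rw [← ENNReal.rpow_mul, one_div_mul_cancel hp1.ne', ENNReal.rpow_one] at this
    exact this

end Stmt13Aux


/-- If `∑_{u ∈ Chi^{n_k}(root)} |μ_u|^{-p*} → ∞` along some increasing sequence,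
then there are `f ∈ ℓ^p(V,μ)` and a subsequence with `B^{n_{k_j}} f → e_root` in
norm; in particular `B` has an orbit with `e_root` as a limit point. -/
theorem stmt13 {V 𝕜 : Type*} [RCLike 𝕜] [Countable V] [Nonempty V] [DecidableEq V]
    {E : V → V → Prop} (hT : DirTree E) (μ : V → 𝕜) (hμ : ∀ w, μ w ≠ 0)
    (o : V) (ho : ∀ u, ¬ E u o) (hreach : ∀ w : V, ∃ m : ℕ, w ∈ chiIter E m o)
    (p : ℝ) (hp : 1 < p)
    (hB : ∃ C : ℝ≥0∞, C ≠ ⊤ ∧ ∀ f : V → 𝕜, pnorm μ p (Bop E f) ≤ C * pnorm μ p f)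
    (n : ℕ → ℕ) (hmono : StrictMono n) (hpos : ∀ k, 0 < n k)
    (hdiv : Tendsto (fun k => ∑' u : chiIter E (n k) o,
        (‖μ u.1‖₊ : ℝ≥0∞) ^ (-(p / (p - 1)))) atTop (nhds ⊤)) :
    ∃ f : V → 𝕜, pnorm μ p f ≠ ⊤ ∧ ∃ j : ℕ → ℕ, StrictMono j ∧
      Tendsto (fun i => pnorm μ p
          (fun w => (Bop E)^[n (j i)] f w - (if w = o then 1 else 0)))
        atTop (nhds 0) := by
  classical
  obtain ⟨C, hC, hCB⟩ := hB
  have hp0 : 0 < p := by linarith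
  have hpn : ∀ f : V → 𝕜, pnorm μ p f = (Stmt13Aux.NN μ p f) ^ (1 / p) := fun f => rfl
  obtain ⟨K, hKtop, hK1, hK⟩ : ∃ K : ℝ≥0∞, K ≠ ⊤ ∧ 1 ≤ K ∧
      ∀ f : V → 𝕜, Stmt13Aux.NN μ p (Bop E f) ≤ K * Stmt13Aux.NN μ p f := by
    refine ⟨max (C ^ p) 1, ?_, le_max_right _ _, ?_⟩
    · simp [hC, hp0.le]
    · intro f
      have h := ENNReal.rpow_le_rpow (hCB f) hp0.le
      rw [hpn, hpn, ENNReal.mul_rpow_of_nonneg _ _ hp0.le, ← ENNReal.rpow_mul, ← ENNReal.rpow_mul,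
        one_div_mul_cancel hp0.ne', ENNReal.rpow_one, ENNReal.rpow_one] at h
      exact h.trans (by gcongr; exact le_max_left _ _)
  obtain ⟨lev, hmem, hlev, h0, hpar⟩ := Stmt13Aux.exists_lev hT o ho hreach
  have hstep : ∀ (i a : ℕ), ∃ k, a < k ∧ ∃ (F : Finset V) (g : V → 𝕜),
      (∀ u ∈ F, u ∈ chiIter E (n k) o) ∧ (∀ u, u ∉ F → g u = 0) ∧
      ∑ u ∈ F, g u = 1 ∧ Stmt13Aux.NN μ p g ≤ (2⁻¹) ^ i / K ^ (n a) := by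
    intro i a
    set ε : ℝ≥0∞ := (2⁻¹) ^ i / K ^ (n a) with hε
    have hε0 : ε ≠ 0 := by
      rw [hε]
      refine ENNReal.div_ne_zero.2 ⟨?_, ENNReal.pow_ne_top hKtop⟩
      exact pow_ne_zero _ (by simp)
    have hlt : (ε⁻¹) ^ (1 / (p - 1)) < ⊤ :=
      ENNReal.rpow_lt_top_of_nonneg (by have : 0 < p - 1 := by linarith
                                        positivity) (by simpa using hε0)
    obtain ⟨k, hk, hak⟩ := ((hdiv.eventually (lt_mem_nhds hlt)).and (eventually_gt_atTop a)).exists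
    exact ⟨k, hak, Stmt13Aux.exists_g μ hμ p hp _ ε hk⟩
  choose nxt hnxt FF gg hFF hgg hsum hNN using hstep
  let j' : ℕ → ℕ := fun i => Nat.rec 0 (fun i a => nxt i a) i
  have hj'succ : ∀ i, j' (i + 1) = nxt i (j' i) := fun i => rfl
  have hj' : StrictMono j' := strictMono_nat_of_lt_succ fun i => by
    rw [hj'succ]
    exact hnxt _ _
  set j : ℕ → ℕ := fun i => j' (i + 1) with hj
  have hjm : StrictMono j := fun a b h => hj' (Nat.add_lt_add_right h 1)
  have hnj : StrictMono (fun i => n (j i)) := hmono.comp hjm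
  set F : ℕ → Finset V := fun i => FF i (j' i) with hFdef
  set g : ℕ → V → 𝕜 := fun i => gg i (j' i) with hgdef
  have hF : ∀ i, ∀ u ∈ F i, lev u = n (j i) := fun i u hu =>
    (hmem _ _).1 (hFF i (j' i) u hu)
  have hg : ∀ i u, u ∉ F i → g i u = 0 := fun i => hgg i (j' i)
  have hs : ∀ i, ∑ u ∈ F i, g i u = 1 := fun i => hsum i (j' i)
  have hN : ∀ i, Stmt13Aux.NN μ p (g i) ≤ (2⁻¹) ^ i / K ^ (n (j' i)) := fun i => hNN i (j' i)
  have hN1 : ∀ i m, m ≤ n (j' i) → K ^ m * Stmt13Aux.NN μ p (g i) ≤ (2⁻¹) ^ i := by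
    intro i m hm
    calc K ^ m * Stmt13Aux.NN μ p (g i) ≤ K ^ (n (j' i)) * ((2⁻¹) ^ i / K ^ (n (j' i))) := by
          gcongr
          exact hN i
      _ ≤ (2⁻¹) ^ i := ENNReal.mul_div_le
  obtain ⟨f, hf1, hf2⟩ : ∃ f : V → 𝕜, (∀ i v, lev v = n (j i) → f v = g i v) ∧
      (∀ v, (∀ i, lev v ≠ n (j i)) → f v = 0) := by
    refine ⟨fun v => if h : ∃ i, lev v = n (j i) then g h.choose v else 0, ?_, ?_⟩
    · intro i v hv
      have h : ∃ i, lev v = n (j i) := ⟨i, hv⟩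
      have : h.choose = i := hnj.injective (h.choose_spec.symm.trans hv)
      simp only [dif_pos h]
      rw [this]
    · intro v hv
      have h : ¬ ∃ i, lev v = n (j i) := fun ⟨i, hi⟩ => hv i hi
      simp only [dif_neg h]
  have hgen : ∀ (h : V → 𝕜) (G : ℕ → V → 𝕜), (∀ v, h v = 0 ∨ ∃ i, h v = G i v) →
      Stmt13Aux.NN μ p h ≤ ∑' i, Stmt13Aux.NN μ p (G i) := by
    intro h G hG
    unfold Stmt13Aux.NN
    rw [ENNReal.tsum_comm]
    refine ENNReal.tsum_le_tsum fun v => ?_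
    rcases hG v with hv | ⟨i, hv⟩
    · rw [hv]
      simp [hp0]
    · rw [hv]
      exact ENNReal.le_tsum (f := fun i => (‖G i v * μ v‖₊ : ℝ≥0∞) ^ p) i
  refine ⟨f, ?_, j, hjm, ?_⟩
  · rw [hpn]
    refine ENNReal.rpow_ne_top_of_nonneg (by positivity) ?_
    have h1 : Stmt13Aux.NN μ p f ≤ ∑' i, Stmt13Aux.NN μ p (g i) := by
      refine hgen f g fun v => ?_
      by_cases h : ∃ i, lev v = n (j i)
      · obtain ⟨i, hi⟩ := h
        exact Or.inr ⟨i, hf1 i v hi⟩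
      · exact Or.inl (hf2 v fun i hi => h ⟨i, hi⟩)
    have h2 : ∑' i, Stmt13Aux.NN μ p (g i) ≤ ∑' i : ℕ, (2⁻¹ : ℝ≥0∞) ^ i :=
      ENNReal.tsum_le_tsum fun i => by simpa using hN1 i 0 (Nat.zero_le _)
    have h3 : ∑' i : ℕ, (2⁻¹ : ℝ≥0∞) ^ i = 2 := by
      rw [ENNReal.tsum_geometric, ENNReal.one_sub_inv_two, inv_inv]
    exact ne_top_of_le_ne_top (by simp) ((h1.trans h2).trans h3.le)
  · have hbound : ∀ a, Stmt13Aux.NN μ p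
        (fun w => (Bop E)^[n (j a)] f w - (if w = o then 1 else 0)) ≤ (2⁻¹) ^ a := by
      intro a
      have h1 := hgen (fun w => (Bop E)^[n (j a)] f w - (if w = o then 1 else 0))
        (fun i => (Bop E)^[n (j a)] (g (a + 1 + i))) (by
        intro w
        by_cases hw : w = o
        · left
          subst hw
          have e := Stmt13Aux.iter_congr lev hlev (n (j a)) f (g a) 0
            (fun v hv => hf1 a v (by omega)) w ((h0 w).2 rfl)
          have e2 := Stmt13Aux.iter_root hT w lev hlev h0 hpar (n (j a)) (F a) (g a) (hF a) (hg a)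
          simp only [if_true]
          rw [e, e2, hs, sub_self]
        · have hl : lev w ≠ 0 := fun h => hw ((h0 w).1 h)
          simp only [if_neg hw, sub_zero]
          by_cases h : ∃ b, lev w + n (j a) = n (j b)
          · right
            obtain ⟨b, hb⟩ := h
            have hab : a < b := hnj.lt_iff_lt.1 (show n (j a) < n (j b) by omega)
            refine ⟨b - (a + 1), ?_⟩
            have : a + 1 + (b - (a + 1)) = b := by omega
            rw [this]
            exact Stmt13Aux.iter_congr lev hlev (n (j a)) f (g b) (lev w)
              (fun v hv => hf1 b v (by omega)) w rfl
          · left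
            rw [Stmt13Aux.iter_congr lev hlev (n (j a)) f (fun _ => 0) (lev w)
              (fun v hv => hf2 v (fun i hi => h ⟨i, by omega⟩)) w rfl, Stmt13Aux.iter_zero])
      refine h1.trans ?_
      have h2 : ∀ i, Stmt13Aux.NN μ p ((Bop E)^[n (j a)] (g (a + 1 + i)))
          ≤ (2⁻¹) ^ (a + 1) * (2⁻¹) ^ i := fun i => by
        refine (Stmt13Aux.NN_iter μ p K hK _ _).trans ?_
        rw [← pow_add]
        exact hN1 _ _ (hmono.monotone (hj'.monotone (show a + 1 ≤ a + 1 + i by omega)))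
      refine (ENNReal.tsum_le_tsum h2).trans ?_
      rw [ENNReal.tsum_mul_left, ENNReal.tsum_geometric, ENNReal.one_sub_inv_two, inv_inv,
        pow_succ, mul_assoc, ENNReal.inv_mul_cancel (by simp) (by simp), mul_one]
    have hlim : Tendsto (fun a : ℕ => ((2⁻¹ : ℝ≥0∞) ^ a) ^ (1 / p)) atTop (nhds 0) := by
      have h1 : Tendsto (fun a : ℕ => (2⁻¹ : ℝ≥0∞) ^ a) atTop (nhds 0) :=
        ENNReal.tendsto_pow_atTop_nhds_zero_of_lt_one (by simp)
      have h2 := ((ENNReal.continuous_rpow_const (y := 1 / p)).tendsto 0).comp h1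
      rw [ENNReal.zero_rpow_of_pos (by positivity)] at h2
      exact h2
    refine tendsto_of_tendsto_of_tendsto_of_le_of_le tendsto_const_nhds hlim
      (fun _ => zero_le) (fun a => ?_)
    exact ENNReal.rpow_le_rpow (hbound a) (by positivity)
end

section
/- Consider the unrooted directed tree with vertices $\{\mathrm{o}_k\}_{k\geq0}\cup\{u_k\}_{k\geq1}\cup\{v_k\}_{k\geq1}$, edges $\mathrm{o}_{k+1}\to\mathrm{o}_k$, $\mathrm{o}_0\to u_1$, $\mathrm{o}_0\to v_1$, $u_k\to u_{k+1}$, $v_k\to v_{k+1}$, and weight $\mu_{\mathrm{o}_k}=1$, $\mu_{u_k}=\mu_{v_k}=2^{-k}$. Let $1<p<\infty$ and let $f$ be defined by $f(u_{2^k})=1$, $f(v_{2^k})=-1$ for all $k\geq0$ and $f=0$ elsewhere. Then $f\in\ell^p(V,\mu)$, the backward shift $B$ is bounded with $\|B\|=2^{2-1/p}$, and $B^{2^k-1}f\to e_{u_1}-e_{v_1}$ in $\ell^p(V,\mu)$ as $k\to\infty$; in particular $B$ has an orbit with a nonzero limit point. -/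
open scoped ENNReal NNReal
open Filter

/-- Vertices of the unrooted tree: a backward chain `o_k` (`k ≥ 0`) and two
forward branches; `u k` denotes `u_{k+1}` and `v k` denotes `v_{k+1}`. -/
inductive V17 where
  | o : ℕ → V17
  | u : ℕ → V17
  | v : ℕ → V17

/-- Edges: `o_{k+1} → o_k`, `o_0 → u_1`, `o_0 → v_1`, `u_k → u_{k+1}`,
`v_k → v_{k+1}`. -/
inductive E17 : V17 → V17 → Prop where
  | oo (k : ℕ) : E17 (.o (k + 1)) (.o k)
  | ou : E17 (.o 0) (.u 0)
  | ov : E17 (.o 0) (.v 0)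
  | uu (k : ℕ) : E17 (.u k) (.u (k + 1))
  | vv (k : ℕ) : E17 (.v k) (.v (k + 1))

/-- The weight: `μ_{o_k} = 1`, `μ_{u_k} = μ_{v_k} = 2^{-k}`. -/
noncomputable def mu17 : V17 → ℝ
  | .o _ => 1
  | .u k => 2 ^ (-(k + 1 : ℤ))
  | .v k => 2 ^ (-(k + 1 : ℤ))

open Classical in
/-- The function `f` with `f(u_{2^k}) = 1`, `f(v_{2^k}) = -1` and `f = 0`
elsewhere. -/
noncomputable def f17 : V17 → ℝ
  | .o _ => 0
  | .u k => if ∃ j : ℕ, k + 1 = 2 ^ j then 1 else 0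
  | .v k => if ∃ j : ℕ, k + 1 = 2 ^ j then -1 else 0

/-- The target function `e_{u_1} - e_{v_1}`. -/
noncomputable def g17 : V17 → ℝ
  | .u 0 => 1
  | .v 0 => -1
  | _ => 0

/-- The vertex set as a disjoint union of three copies of `ℕ`. -/
def eqv17 : ℕ ⊕ (ℕ ⊕ ℕ) ≃ V17 where
  toFun x := match x with
    | .inl k => .o k
    | .inr (.inl k) => .u k
    | .inr (.inr k) => .v k
  invFun w := match w with
    | .o k => .inl k
    | .u k => .inr (.inl k)
    | .v k => .inr (.inr k)
  left_inv x := by rcases x with k | k | k <;> rfl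
  right_inv w := by rcases w with k | k | k <;> rfl

theorem tsum17 (F : V17 → ℝ≥0∞) :
    ∑' w, F w = ∑' k, F (.o k) + (∑' k, F (.u k) + ∑' k, F (.v k)) := by
  rw [← eqv17.tsum_eq F, Summable.tsum_sum ENNReal.summable ENNReal.summable,
    Summable.tsum_sum ENNReal.summable ENNReal.summable]
  rfl

theorem tsum_single17 (E : V17 → Prop) (a : V17) (h : ∀ w, E w ↔ w = a) (f : V17 → ℝ) :
    ∑' u : {u // E u}, f u = f a := by
  rw [tsum_eq_single (⟨a, (h a).2 rfl⟩ : {u // E u})]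
  rintro ⟨b, hb⟩ hne
  exact absurd (Subtype.ext ((h b).1 hb)) hne

theorem Bop_os (f : V17 → ℝ) (k : ℕ) : Bop E17 f (.o (k + 1)) = f (.o k) := by
  apply tsum_single17 (fun u => E17 (.o (k + 1)) u)
  intro w
  constructor
  · rintro ⟨⟩; rfl
  · rintro rfl; constructor

theorem Bop_u (f : V17 → ℝ) (k : ℕ) : Bop E17 f (.u k) = f (.u (k + 1)) := by
  apply tsum_single17 (fun u => E17 (.u k) u)
  intro w
  constructor
  · rintro ⟨⟩; rfl
  · rintro rfl; constructor

theorem Bop_v (f : V17 → ℝ) (k : ℕ) : Bop E17 f (.v k) = f (.v (k + 1)) := by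
  apply tsum_single17 (fun u => E17 (.v k) u)
  intro w
  constructor
  · rintro ⟨⟩; rfl
  · rintro rfl; constructor

theorem Bop_o0 (f : V17 → ℝ) : Bop E17 f (.o 0) = f (.u 0) + f (.v 0) := by
  classical
  unfold Bop
  have hne : (⟨.u 0, E17.ou⟩ : {u // E17 (.o 0) u}) ≠ ⟨.v 0, E17.ov⟩ := by
    intro h; cases congrArg Subtype.val h
  rw [tsum_eq_sum (s := {(⟨.u 0, E17.ou⟩ : {u // E17 (.o 0) u}), ⟨.v 0, E17.ov⟩}),
    Finset.sum_pair hne]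
  rintro ⟨b, hb⟩ hb'
  exfalso
  apply hb'
  cases hb <;> simp

theorem mu_o (k : ℕ) : mu17 (.o k) = 1 := rfl

theorem mu_u (k : ℕ) : mu17 (.u k) = (1 / 2) ^ (k + 1) := by
  change (2 : ℝ) ^ (-(k + 1 : ℤ)) = _
  rw [zpow_neg, one_div, inv_pow]; norm_cast

theorem mu_v (k : ℕ) : mu17 (.v k) = (1 / 2) ^ (k + 1) := mu_u k

/-- The `p`-th power of the weighted norm. -/
noncomputable def S17 (p : ℝ) (f : V17 → ℝ) : ℝ≥0∞ :=
  ∑' w, (‖f w * mu17 w‖₊ : ℝ≥0∞) ^ p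

theorem pnorm_eq (p : ℝ) (f : V17 → ℝ) : pnorm mu17 p f = S17 p f ^ (1 / p) := rfl

theorem two_scale (p : ℝ) (hp : 1 < p) (x : ℝ) (k : ℕ) :
    (‖x * (1 / 2) ^ k‖₊ : ℝ≥0∞) ^ p = 2 ^ p * (‖x * (1 / 2) ^ (k + 1)‖₊ : ℝ≥0∞) ^ p := by
  rw [← ENNReal.mul_rpow_of_nonneg _ _ (by linarith)]
  congr 1
  have h : x * (1 / 2) ^ k = 2 * (x * (1 / 2) ^ (k + 1)) := by ring
  rw [h, nnnorm_mul]
  push_cast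
  congr 1
  have : ‖(2 : ℝ)‖₊ = 2 := by ext; simp
  rw [this]; rfl

theorem S_Bop_le (p : ℝ) (hp : 1 < p) (f : V17 → ℝ) :
    S17 p (Bop E17 f) ≤ 2 ^ (2 * p - 1) * S17 p f := by
  have hK1 : (1 : ℝ≥0∞) ≤ 2 ^ (2 * p - 1) := ENNReal.one_le_rpow (by norm_num) (by linarith)
  have hKp : (2 : ℝ≥0∞) ^ p ≤ 2 ^ (2 * p - 1) :=
    ENNReal.rpow_le_rpow_of_exponent_le (by norm_num) (by linarith)
  unfold S17
  rw [tsum17, tsum17]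
  rw [tsum_eq_zero_add' (f := fun k => (‖Bop E17 f (.o k) * mu17 (.o k)‖₊ : ℝ≥0∞) ^ p)
    ENNReal.summable,
    tsum_eq_zero_add' (f := fun k => (‖f (.u k) * mu17 (.u k)‖₊ : ℝ≥0∞) ^ p) ENNReal.summable,
    tsum_eq_zero_add' (f := fun k => (‖f (.v k) * mu17 (.v k)‖₊ : ℝ≥0∞) ^ p) ENNReal.summable]
  simp only [Bop_os, Bop_u, Bop_v, Bop_o0, mu_o, mu_u, mu_v, mul_one, zero_add]
  have hsc : ∀ c : ℕ → ℝ, ∑' k, (‖c k * (1 / 2) ^ (k + 1)‖₊ : ℝ≥0∞) ^ p =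
      2 ^ p * ∑' k, (‖c k * (1 / 2) ^ (k + 1 + 1)‖₊ : ℝ≥0∞) ^ p := fun c => by
    rw [← ENNReal.tsum_mul_left]
    exact tsum_congr fun k => two_scale p hp _ _
  rw [hsc fun k => f (.u (k + 1)), hsc fun k => f (.v (k + 1))]
  have h0 : (‖f (.u 0) + f (.v 0)‖₊ : ℝ≥0∞) ^ p ≤ 2 ^ (2 * p - 1) *
      ((‖f (.u 0) * (1 / 2) ^ 1‖₊ : ℝ≥0∞) ^ p + (‖f (.v 0) * (1 / 2) ^ 1‖₊ : ℝ≥0∞) ^ p) := by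
    have e : (2 : ℝ≥0∞) ^ (2 * p - 1) = 2 ^ (p - 1) * 2 ^ p := by
      rw [← ENNReal.rpow_add _ _ (by norm_num) (by norm_num)]; congr 1; ring
    have hu := two_scale p hp (f (.u 0)) 0
    have hv := two_scale p hp (f (.v 0)) 0
    simp only [pow_zero, mul_one, zero_add] at hu hv
    rw [e, mul_assoc, mul_add, ← hu, ← hv]
    refine le_trans ?_ (ENNReal.rpow_add_le_mul_rpow_add_rpow _ _ hp.le)
    refine ENNReal.rpow_le_rpow ?_ (by linarith)
    exact_mod_cast nnnorm_add_le _ _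
  set K : ℝ≥0∞ := 2 ^ (2 * p - 1)
  set O := ∑' k, (‖f (.o k)‖₊ : ℝ≥0∞) ^ p
  refine (add_le_add (add_le_add h0 (le_mul_of_one_le_left' hK1))
    (add_le_add (mul_le_mul_left hKp _) (mul_le_mul_left hKp _))).trans (le_of_eq ?_)
  simp only [pow_one]
  ring

theorem K_root (p : ℝ) (hp : 1 < p) :
    ((2 : ℝ≥0∞) ^ (2 * p - 1)) ^ (1 / p) = 2 ^ (2 - 1 / p) := by
  rw [← ENNReal.rpow_mul]; congr 1; field_simp

theorem pnorm_Bop_le (p : ℝ) (hp : 1 < p) (f : V17 → ℝ) :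
    pnorm mu17 p (Bop E17 f) ≤ 2 ^ (2 - 1 / p) * pnorm mu17 p f := by
  have h : 0 ≤ 1 / p := by positivity
  rw [pnorm_eq, pnorm_eq, ← K_root p hp, ← ENNReal.mul_rpow_of_nonneg _ _ h]
  exact ENNReal.rpow_le_rpow (S_Bop_le p hp f) h

/-- The test function `e_{u_1} + e_{v_1}`. -/
noncomputable def t17 : V17 → ℝ
  | .u 0 => 1
  | .v 0 => 1
  | _ => 0

theorem half_nn : ((‖(1 / 2 : ℝ)‖₊ : ℝ≥0) : ℝ≥0∞) = 2⁻¹ := by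
  have : ‖(1 / 2 : ℝ)‖₊ = 2⁻¹ := by ext; simp
  rw [this, ENNReal.coe_inv (by norm_num)]; rfl

theorem S_t (p : ℝ) (hp : 1 < p) : S17 p t17 = 2 ^ (1 - p) := by
  have hp0 : 0 < p := by linarith
  unfold S17
  rw [tsum17, tsum_eq_single (f := fun k => (‖t17 (.u k) * mu17 (.u k)‖₊ : ℝ≥0∞) ^ p) 0,
    tsum_eq_single (f := fun k => (‖t17 (.v k) * mu17 (.v k)‖₊ : ℝ≥0∞) ^ p) 0]
  · simp only [t17, mu_u, mu_v, zero_mul, one_mul, zero_add, pow_one, half_nn]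
    simp only [nnnorm_zero, ENNReal.coe_zero, ENNReal.zero_rpow_of_pos hp0, tsum_zero, zero_add]
    rw [← two_mul, ENNReal.rpow_sub _ _ (by norm_num) (by norm_num), ENNReal.rpow_one,
      ENNReal.inv_rpow, div_eq_mul_inv]
  · intro k hk
    obtain ⟨j, rfl⟩ := Nat.exists_eq_succ_of_ne_zero hk
    simp [t17, hp0]
  · intro k hk
    obtain ⟨j, rfl⟩ := Nat.exists_eq_succ_of_ne_zero hk
    simp [t17, hp0]

theorem S_Bt (p : ℝ) (hp : 1 < p) : 2 ^ p ≤ S17 p (Bop E17 t17) := by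
  refine le_trans (le_of_eq ?_) (ENNReal.le_tsum (V17.o 0))
  rw [Bop_o0, mu_o]
  congr 1
  have : ‖(t17 (.u 0) + t17 (.v 0)) * 1‖₊ = 2 := by ext; norm_num [t17]
  rw [this]; rfl

theorem lower (p : ℝ) (hp : 1 < p) (C : ℝ≥0∞)
    (hC : ∀ f : V17 → ℝ, pnorm mu17 p (Bop E17 f) ≤ C * pnorm mu17 p f) :
    2 ^ (2 - 1 / p) ≤ C := by
  have h := hC t17
  have hp0 : p ≠ 0 := by linarith
  have h2 : (2 : ℝ≥0∞) ≤ pnorm mu17 p (Bop E17 t17) := by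
    have := ENNReal.rpow_le_rpow (S_Bt p hp) (z := 1 / p) (by positivity)
    rwa [← ENNReal.rpow_mul, mul_one_div_cancel hp0, ENNReal.rpow_one] at this
  have h3 : pnorm mu17 p t17 = 2 ^ (1 / p - 1) := by
    rw [pnorm_eq, S_t p hp, ← ENNReal.rpow_mul]; congr 1; field_simp
  have h4 := h2.trans h
  rw [h3] at h4
  have h5 := mul_le_mul_left h4 ((2 : ℝ≥0∞) ^ (1 - 1 / p))
  rw [mul_assoc, ← ENNReal.rpow_add _ _ (by norm_num) (by norm_num)] at h5
  have e : 1 / p - 1 + (1 - 1 / p) = 0 := by ring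
  rw [e, ENNReal.rpow_zero, mul_one] at h5
  refine le_trans (le_of_eq ?_) h5
  have e2 : 2 - 1 / p = 1 + (1 - 1 / p) := by ring
  rw [e2, ENNReal.rpow_add _ _ (by norm_num) (by norm_num), ENNReal.rpow_one]

/-- The profile of `f17` along a branch. -/
noncomputable def a17 (k : ℕ) : ℝ := f17 (.u k)

theorem f_v (k : ℕ) : f17 (.v k) = - a17 k := by
  simp only [a17, f17]; split_ifs <;> simp

theorem iter17 (n : ℕ) : (∀ k, (Bop E17)^[n] f17 (.o k) = 0) ∧
    (∀ k, (Bop E17)^[n] f17 (.u k) = a17 (k + n)) ∧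
    (∀ k, (Bop E17)^[n] f17 (.v k) = - a17 (k + n)) := by
  induction n with
  | zero => exact ⟨fun k => rfl, fun k => rfl, fun k => f_v k⟩
  | succ n ih =>
    obtain ⟨h1, h2, h3⟩ := ih
    simp only [Function.iterate_succ_apply']
    refine ⟨fun k => ?_, fun k => ?_, fun k => ?_⟩
    · cases k with
      | zero => rw [Bop_o0, h2, h3]; ring
      | succ k => rw [Bop_os, h1]
    · rw [Bop_u, h2]; congr 1; ring
    · rw [Bop_v, h3]; congr 2; ring

theorem term_le (p : ℝ) (hp : 1 < p) (x : ℝ) (hx : |x| ≤ 1) (k : ℕ) :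
    (‖x * (1 / 2) ^ (k + 1)‖₊ : ℝ≥0∞) ^ p ≤ 2⁻¹ ^ (k + 1) := by
  have h : (‖x * (1 / 2) ^ (k + 1)‖₊ : ℝ≥0∞) ≤ 2⁻¹ ^ (k + 1) := by
    rw [nnnorm_mul, nnnorm_pow]
    push_cast
    rw [half_nn]
    refine mul_le_of_le_one_left' ?_
    exact_mod_cast (show ‖x‖₊ ≤ 1 from hx)
  have h1 : (2⁻¹ : ℝ≥0∞) ^ (k + 1) ≤ 1 := pow_le_one₀ (by simp) (by simp)
  exact (ENNReal.rpow_le_self_of_le_one (h.trans h1) hp.le).trans h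

theorem sum_half : ∑' k : ℕ, (2⁻¹ : ℝ≥0∞) ^ (k + 1) ≠ ⊤ := by
  rw [ENNReal.tsum_geometric_add_one]
  norm_num

theorem a_abs (k : ℕ) : |a17 k| ≤ 1 := by
  simp only [a17, f17]; split_ifs <;> simp

theorem S_f (p : ℝ) (hp : 1 < p) : S17 p f17 ≠ ⊤ := by
  have hp0 : 0 < p := by linarith
  unfold S17
  rw [tsum17]
  have ho : ∀ k, f17 (.o k) = 0 := fun k => rfl
  have hu : ∀ k, f17 (.u k) = a17 k := fun k => rfl
  simp only [ho, hu, f_v, mu_u, mu_v, zero_mul, nnnorm_zero, ENNReal.coe_zero,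
    ENNReal.zero_rpow_of_pos hp0, tsum_zero, zero_add]
  refine ENNReal.add_ne_top.2 ⟨?_, ?_⟩
  · exact ne_top_of_le_ne_top sum_half (ENNReal.tsum_le_tsum fun k => term_le p hp _ (a_abs k) k)
  · exact ne_top_of_le_ne_top sum_half
      (ENNReal.tsum_le_tsum fun k => term_le p hp _ (by rw [abs_neg]; exact a_abs k) k)

theorem a_zero (k j : ℕ) (hj : 0 < j) (hjk : j < k) : a17 (j + (2 ^ k - 1)) = 0 := by
  have h1 : k < 2 ^ k := Nat.lt_two_pow_self
  simp only [a17, f17]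
  rw [if_neg]
  rintro ⟨i, hi⟩
  have h2 : 2 ^ k < 2 ^ i := by omega
  have h3 : k < i := (Nat.pow_lt_pow_iff_right (by norm_num)).1 h2
  have h4 : 2 ^ (k + 1) ≤ 2 ^ i := Nat.pow_le_pow_right (by norm_num) h3
  rw [pow_succ] at h4
  omega

theorem a_one (k : ℕ) : a17 (0 + (2 ^ k - 1)) = 1 := by
  simp only [a17, f17]
  rw [if_pos]
  have : 0 < 2 ^ k := by positivity
  exact ⟨k, by omega⟩

theorem branch_le (p : ℝ) (hp : 1 < p) (k : ℕ) (d : ℕ → ℝ) (hd : ∀ j, |d j| ≤ 1)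
    (hz : ∀ j, j < k → d j = 0) :
    ∑' j, (‖d j * (1 / 2) ^ (j + 1)‖₊ : ℝ≥0∞) ^ p ≤ ∑' j, 2⁻¹ ^ (j + k + 1) := by
  have hp0 : 0 < p := by linarith
  rw [← Summable.sum_add_tsum_nat_add' (k := k) ENNReal.summable, Finset.sum_eq_zero, zero_add]
  · exact ENNReal.tsum_le_tsum fun j => term_le p hp _ (hd _) _
  · intro j hj
    simp [hz j (Finset.mem_range.1 hj), hp0]

theorem S_diff (p : ℝ) (hp : 1 < p) (k : ℕ) (hk : 0 < k) :
    S17 p (fun w => (Bop E17)^[2 ^ k - 1] f17 w - g17 w) ≤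
      ∑' j : ℕ, 2⁻¹ ^ (j + k + 1) + ∑' j : ℕ, 2⁻¹ ^ (j + k + 1) := by
  have hp0 : 0 < p := by linarith
  obtain ⟨h1, h2, h3⟩ := iter17 (2 ^ k - 1)
  unfold S17
  rw [tsum17]
  have ho : ∀ j, g17 (.o j) = 0 := fun j => rfl
  simp only [h1, h2, h3, ho, mu_u, mu_v, sub_zero, zero_mul, nnnorm_zero, ENNReal.coe_zero,
    ENNReal.zero_rpow_of_pos hp0, tsum_zero, zero_add]
  refine add_le_add (branch_le p hp k _ ?_ ?_) (branch_le p hp k _ ?_ ?_)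
  · intro j
    cases j with
    | zero => rw [a_one]; simp [g17]
    | succ j => simpa [g17] using a_abs _
  · intro j hj
    cases j with
    | zero => rw [a_one]; simp [g17]
    | succ j => rw [a_zero k _ (by omega) hj]; simp [g17]
  · intro j
    cases j with
    | zero => rw [a_one]; simp [g17]
    | succ j => simpa [g17] using a_abs _
  · intro j hj
    cases j with
    | zero => rw [a_one]; simp [g17]
    | succ j => rw [a_zero k _ (by omega) hj]; simp [g17]

theorem conv17 (p : ℝ) (hp : 1 < p) :
    Tendsto (fun k : ℕ => pnorm mu17 p (fun w => (Bop E17)^[2 ^ k - 1] f17 w - g17 w))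
      atTop (nhds 0) := by
  have hp0 : 0 < 1 / p := by positivity
  have ht := ENNReal.tendsto_sum_nat_add (fun k => (2⁻¹ : ℝ≥0∞) ^ (k + 1)) sum_half
  have hs : Tendsto (fun k : ℕ => S17 p (fun w => (Bop E17)^[2 ^ k - 1] f17 w - g17 w))
      atTop (nhds 0) := by
    have ht2 := ht.add ht
    rw [add_zero] at ht2
    refine tendsto_of_tendsto_of_tendsto_of_le_of_le' tendsto_const_nhds ht2
      (Eventually.of_forall fun _ => bot_le) ?_
    filter_upwards [eventually_gt_atTop 0] with k hk
    exact S_diff p hp k hk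
  have := (ENNReal.continuous_rpow_const (y := 1 / p)).tendsto 0 |>.comp hs
  rw [ENNReal.zero_rpow_of_pos hp0] at this
  exact this

/-- Example: on the unrooted tree above, `f17 ∈ ℓ^p(V,μ)`, the backward shift is
bounded with `‖B‖ = 2^{2 - 1/p}`, and `B^{2^k - 1} f17 → e_{u_1} - e_{v_1}`;
in particular `B` has an orbit with a nonzero limit point. -/
theorem stmt17 (p : ℝ) (hp : 1 < p) :
    pnorm mu17 p f17 ≠ ⊤ ∧
    ((∃ C : ℝ≥0∞, C ≠ ⊤ ∧
        ∀ f : V17 → ℝ, pnorm mu17 p (Bop E17 f) ≤ C * pnorm mu17 p f) ∧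
      sInf {C : ℝ≥0∞ |
          ∀ f : V17 → ℝ, pnorm mu17 p (Bop E17 f) ≤ C * pnorm mu17 p f}
        = (2 : ℝ≥0∞) ^ (2 - 1 / p)) ∧
    Tendsto (fun k : ℕ => pnorm mu17 p (fun w => (Bop E17)^[2 ^ k - 1] f17 w - g17 w))
      atTop (nhds 0) ∧
    (g17 ≠ 0 ∧ ∃ n : ℕ → ℕ, StrictMono n ∧
      Tendsto (fun k : ℕ => pnorm mu17 p (fun w => (Bop E17)^[n k] f17 w - g17 w))
        atTop (nhds 0)) := by
  refine ⟨?_, ⟨⟨2 ^ (2 - 1 / p), ?_, pnorm_Bop_le p hp⟩, ?_⟩, conv17 p hp, ?_, ?_⟩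
  · rw [pnorm_eq]
    exact ENNReal.rpow_ne_top_of_nonneg (by positivity) (S_f p hp)
  · refine ENNReal.rpow_ne_top_of_nonneg ?_ (by norm_num)
    have : 1 / p ≤ 1 := by rw [div_le_one (by linarith)]; exact hp.le
    linarith
  · apply le_antisymm
    · exact sInf_le (pnorm_Bop_le p hp)
    · exact le_sInf fun C hC => lower p hp C hC
  · intro h
    have := congrFun h (.u 0)
    simp [g17] at this
  · refine ⟨fun k => 2 ^ k - 1, ?_, conv17 p hp⟩
    refine strictMono_nat_of_lt_succ fun k => ?_
    have h0 : 0 < 2 ^ k := by positivity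
    have h1 : 2 ^ (k + 1) = 2 ^ k * 2 := pow_succ 2 k
    change 2 ^ k - 1 < 2 ^ (k + 1) - 1
    omega
end
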